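/- Let X ⊆ Y be finite metric spaces with X nonempty and |Y| ≥ k+1 for some k ∈ ℕ. Let s₀ = 0 < s₁ < ⋯ < s_U be the phase change numbers of X and let M ≤ U be an index such that V_s(X) is connected for all s ≥ s_M. If N_k(X,Y) + 2·h(Y,X) < s_{i+1} − s_i for all 0 ≤ i < M, then Λ(L₀X) is a retract of Λ(L_kY): there exist order-preserving maps ι : Λ(L₀X) → Λ(L_kY) and ρ : Λ(L_kY) → Λ(L₀X) with ρ ∘ ι equal to the identity on Λ(L₀X). -/

import Mathlib

open Metric in
/-- The edge relation at scale `s` of the graph with vertex set `V`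
(inside an ambient metric space): an edge between distinct vertices at distance `≤ s`. -/
def adjRel {Y : Type*} [MetricSpace Y] (V : Set Y) (s : ℝ) (a b : Y) : Prop :=
  a ∈ V ∧ b ∈ V ∧ a ≠ b ∧ dist a b ≤ s

/-- Reachability (a path of edges) in the graph with vertex set `V` and edges
between distinct vertices at distance `≤ s`. -/
def Reach {Y : Type*} [MetricSpace Y] (V : Set Y) (s : ℝ) (a b : Y) : Prop :=
  Relation.ReflTransGen (adjRel V s) a b

/-- `S` is (the vertex set of) a connected component of the graph with vertex
set `V` and edges between distinct vertices at distance `≤ s`.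
For `V = X` this graph is the Vietoris–Rips graph `V_s(X)`. -/
def IsCC {Y : Type*} [MetricSpace Y] (V : Set Y) (s : ℝ) (S : Set Y) : Prop :=
  ∃ a ∈ V, S = {b | Reach V s a b}

/-- The vertex set of the Lesnick graph `L_{s,k}(Y)`: the points of `Y` having at
least `k` distinct `s`-neighbours in `Y`. -/
def lesnickVerts (Y : Type*) [MetricSpace Y] (k : ℕ) (s : ℝ) : Set Y :=
  {y | k ≤ Set.ncard {y' : Y | y' ≠ y ∧ dist y y' ≤ s}}

/-- The directional Hausdorff distance `h(Y, X) = max_{y ∈ Y} min_{x ∈ X} d(y, x)`. -/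
noncomputable def dirHaus {Y : Type*} [MetricSpace Y] (X : Set Y) : ℝ :=
  ⨆ y : Y, ⨅ x : X, dist y (x : Y)

/-- `N_k(X, Y) = max_{x ∈ X} min_S max_{y ∈ S} d(x, y)`, the minimum over all
`(k+1)`-element subsets `S ⊆ Y`. -/
noncomputable def Nk {Y : Type*} [MetricSpace Y] (k : ℕ) (X : Set Y) : ℝ :=
  ⨆ x : X, ⨅ S : {S : Finset Y // S.card = k + 1}, ⨆ y : (S : Finset Y), dist (x : Y) (y : Y)

/-- The poset `Λ(L₀X[c])` of layer points of the truncated Vietoris–Rips clustering: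
pairs `(s, S)` with `s ≥ c`, `S` a connected component of `V_s(X)`, and `S` not a
component of `V_r(X)` for any `c ≤ r < s`; ordered as a subset of `ℝ × Set Y`
(componentwise: `≤` on parameters and `⊆` on clusters). `Λ(L₀X) = Λ(L₀X[0])`. -/
def LambdaVR {Y : Type*} [MetricSpace Y] (X : Set Y) (c : ℝ) : Set (ℝ × Set Y) :=
  {p | c ≤ p.1 ∧ IsCC X p.1 p.2 ∧ ∀ r : ℝ, c ≤ r → r < p.1 → ¬ IsCC X r p.2}

/-- The poset `Λ(L_kY)` of layer points of the Lesnick clustering of `Y`: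
pairs `(t, T)` with `t ≥ 0`, `T` a connected component of `L_{t,k}(Y)`, and `T` not
a component of `L_{r,k}(Y)` for any `0 ≤ r < t`; ordered componentwise. -/
def LambdaLes (Y : Type*) [MetricSpace Y] (k : ℕ) : Set (ℝ × Set Y) :=
  {p | 0 ≤ p.1 ∧ IsCC (lesnickVerts Y k p.1) p.1 p.2 ∧
    ∀ r : ℝ, 0 ≤ r → r < p.1 → ¬ IsCC (lesnickVerts Y k r) r p.2}

theorem adjRel.mono {Y : Type*} [MetricSpace Y] {V W : Set Y} {s t : ℝ} (hVW : V ⊆ W)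
    (hst : s ≤ t) {a b : Y} (h : adjRel V s a b) : adjRel W t a b :=
  ⟨hVW h.1, hVW h.2.1, h.2.2.1, h.2.2.2.trans hst⟩

theorem Reach.symm {Y : Type*} [MetricSpace Y] {V : Set Y} {s : ℝ} {a b : Y}
    (h : Reach V s a b) : Reach V s b a := by
  refine Relation.ReflTransGen.mono ?_ _ _ (Relation.ReflTransGen.swap _ _ h)
  rintro x y ⟨hy, hx, hne, hd⟩
  exact ⟨hx, hy, hne.symm, by rwa [dist_comm]⟩

theorem IsCC.subset_verts {Y : Type*} [MetricSpace Y] {V S : Set Y} {s : ℝ}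
    (h : IsCC V s S) : S ⊆ V := by
  obtain ⟨a, ha, rfl⟩ := h
  intro b hb
  rcases Relation.ReflTransGen.cases_tail hb with rfl | ⟨c, -, hc⟩
  · exact ha
  · exact hc.2.1

theorem IsCC.nonempty {Y : Type*} [MetricSpace Y] {V S : Set Y} {s : ℝ}
    (h : IsCC V s S) : S.Nonempty := by
  obtain ⟨a, -, rfl⟩ := h
  exact ⟨a, Relation.ReflTransGen.refl⟩

/-- A component of a graph is contained in every component, of a graph with more edges, that it
meets. -/
theorem IsCC.subset_of_adjRel {Y : Type*} [MetricSpace Y] {V W S T : Set Y} {s t : ℝ}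
    (hadj : ∀ a b, adjRel V s a b → adjRel W t a b) (hS : IsCC V s S) (hT : IsCC W t T)
    (hST : (S ∩ T).Nonempty) : S ⊆ T := by
  obtain ⟨a, -, rfl⟩ := hS
  obtain ⟨b, -, rfl⟩ := hT
  obtain ⟨c, hac, hbc⟩ := hST
  intro d hd
  have hcd : Reach V s c d := Relation.ReflTransGen.trans (Reach.symm hac) hd
  exact Relation.ReflTransGen.trans hbc (Relation.ReflTransGen.mono hadj _ _ hcd)

theorem lesnickVerts_mono {Y : Type*} [MetricSpace Y] [Finite Y] (k : ℕ) :
    Monotone (lesnickVerts Y k) := by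
  intro s t hst y hy
  have hy' : k ≤ _ := hy
  exact hy'.trans (Set.ncard_le_ncard (fun z hz => ⟨hz.1, hz.2.trans hst⟩)
    (Set.toFinite _))

/-- The first coordinate of a layer point is determined monotonically by its cluster. -/
theorem layer_le_of_subset {Y : Type*} [MetricSpace Y] {W : ℝ → Set Y} (hW : Monotone W)
    {s t : ℝ} {S T : Set Y} (hS : IsCC (W s) s S)
    (hmin : ∀ r : ℝ, 0 ≤ r → r < s → ¬ IsCC (W r) r S) (ht : 0 ≤ t)
    (hT : IsCC (W t) t T) (hST : S ⊆ T) : s ≤ t := by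
  by_contra! hlt
  have hTS : T ⊆ S := hT.subset_of_adjRel (fun _ _ => adjRel.mono (hW hlt.le) hlt.le) hS
    (hS.nonempty.mono fun x hx => ⟨hST hx, hx⟩)
  exact hmin t ht hlt (hST.antisymm hTS ▸ hT)

/-- In a finite metric space, a cluster at a nonnegative scale has a smallest nonnegative scale. -/
theorem exists_layer {Y : Type*} [MetricSpace Y] [Finite Y] {W : ℝ → Set Y}
    (hW : ∀ r d : ℝ, (∀ a b : Y, dist a b ≤ r ↔ dist a b ≤ d) → W r = W d)
    {r : ℝ} (hr : 0 ≤ r) {S : Set Y} (hS : IsCC (W r) r S) :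
    ∃ s, 0 ≤ s ∧ IsCC (W s) s S ∧ ∀ u : ℝ, 0 ≤ u → u < s → ¬ IsCC (W u) u S := by
  obtain ⟨y, -⟩ := hS.nonempty
  set D : Set ℝ := Set.range fun p : Y × Y => dist p.1 p.2 with hD
  have hDfin : D.Finite := Set.finite_range _
  have floor : ∀ u : ℝ, 0 ≤ u → IsCC (W u) u S → ∃ d ∈ D, d ≤ u ∧ IsCC (W d) d S := by
    intro u hu hSu
    have hne : (D ∩ Set.Iic u).Nonempty := ⟨0, ⟨(y, y), dist_self y⟩, hu⟩
    obtain ⟨d, ⟨hdD, hdu⟩, hdmax⟩ := Set.exists_max_image _ id (hDfin.inter_of_left _) hne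
    have hiff : ∀ a b : Y, dist a b ≤ u ↔ dist a b ≤ d := fun a b =>
      ⟨fun h => hdmax _ ⟨⟨(a, b), rfl⟩, h⟩, fun h => h.trans hdu⟩
    refine ⟨d, hdD, hdu, ?_⟩
    have hadj : adjRel (W u) u = adjRel (W d) d := by
      ext a b
      simp only [adjRel, hiff, hW u d hiff]
    obtain ⟨a, ha, hSa⟩ := hSu
    refine ⟨a, hW u d hiff ▸ ha, ?_⟩
    simp only [hSa, Reach, hadj]
  obtain ⟨d, hdD, -, hdS⟩ := floor r hr hS
  obtain ⟨s, ⟨hsD, hsS⟩, hsmin⟩ := Set.exists_min_image (D ∩ {d | IsCC (W d) d S}) id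
    (hDfin.inter_of_left _) ⟨d, hdD, hdS⟩
  refine ⟨s, ?_, hsS, fun u hu hus hSu => ?_⟩
  · obtain ⟨p, rfl⟩ := hsD
    exact dist_nonneg
  · obtain ⟨e, heD, heu, heS⟩ := floor u hu hSu
    exact absurd (hsmin e ⟨heD, heS⟩) (not_le.2 (heu.trans_lt hus))

theorem exists_mem_LambdaVR {Y : Type*} [MetricSpace Y] [Finite Y] {X S : Set Y} {r : ℝ}
    (hr : 0 ≤ r) (hS : IsCC X r S) : ∃ s, (s, S) ∈ LambdaVR X 0 :=
  exists_layer (W := fun _ => X) (fun _ _ _ => rfl) hr hS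

theorem exists_mem_LambdaLes {Y : Type*} [MetricSpace Y] [Finite Y] {k : ℕ} {S : Set Y} {r : ℝ}
    (hr : 0 ≤ r) (hS : IsCC (lesnickVerts Y k r) r S) : ∃ s, (s, S) ∈ LambdaLes Y k := by
  refine exists_layer (W := lesnickVerts Y k) (fun r d h => ?_) hr hS
  simp only [lesnickVerts, h]

theorem LambdaVR_fst_le {Y : Type*} [MetricSpace Y] {X : Set Y} {p q : ℝ × Set Y}
    (hp : p ∈ LambdaVR X 0) (hq : q ∈ LambdaVR X 0) (h : p.2 ⊆ q.2) : p.1 ≤ q.1 :=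
  layer_le_of_subset (W := fun _ => X) monotone_const hp.2.1 hp.2.2 hq.1 hq.2.1 h

theorem LambdaLes_fst_le {Y : Type*} [MetricSpace Y] [Finite Y] {k : ℕ} {p q : ℝ × Set Y}
    (hp : p ∈ LambdaLes Y k) (hq : q ∈ LambdaLes Y k) (h : p.2 ⊆ q.2) : p.1 ≤ q.1 :=
  layer_le_of_subset (lesnickVerts_mono k) hp.2.1 hp.2.2 hq.1 hq.2.1 h

theorem dirHaus_nonneg {Y : Type*} [MetricSpace Y] (X : Set Y) : 0 ≤ dirHaus X :=
  Real.iSup_nonneg fun _ => Real.iInf_nonneg fun _ => dist_nonneg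

theorem Nk_nonneg {Y : Type*} [MetricSpace Y] (k : ℕ) (X : Set Y) : 0 ≤ Nk k X :=
  Real.iSup_nonneg fun _ => Real.iInf_nonneg fun _ => Real.iSup_nonneg fun _ => dist_nonneg

/-- A map to a nearest point, moving points by at most the directional Hausdorff distance. -/
theorem exists_nearest {Y : Type*} [MetricSpace Y] [Finite Y] {X : Set Y} (hX : X.Nonempty) :
    ∃ θ : Y → Y, (∀ y, θ y ∈ X) ∧ (∀ y, dist y (θ y) ≤ dirHaus X) ∧ ∀ x ∈ X, θ x = x := by
  have key : ∀ y : Y, ∃ x ∈ X, dist y x ≤ dirHaus X ∧ (y ∈ X → x = y) := by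
    intro y
    by_cases hy : y ∈ X
    · exact ⟨y, hy, by simpa using dirHaus_nonneg X, fun _ => rfl⟩
    · have : Nonempty X := hX.to_subtype
      obtain ⟨x, hx⟩ := exists_eq_ciInf_of_finite (f := fun x : X => dist y (x : Y))
      refine ⟨x, x.2, ?_, fun h => absurd h hy⟩
      exact hx.le.trans (le_ciSup (f := fun y : Y => ⨅ x : X, dist y (x : Y))
        (Set.finite_range _).bddAbove y)
  choose θ h₁ h₂ h₃ using key
  exact ⟨θ, h₁, h₂, h₃⟩

theorem subset_lesnickVerts {Y : Type*} [MetricSpace Y] [Fintype Y] {k : ℕ} (X : Set Y)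
    (hcard : k + 1 ≤ Fintype.card Y) : X ⊆ lesnickVerts Y k (Nk k X) := by
  classical
  intro x hx
  obtain ⟨S₀, -, hS₀⟩ := Finset.exists_subset_card_eq (s := (Finset.univ : Finset Y)) hcard
  have : Nonempty {S : Finset Y // S.card = k + 1} := ⟨⟨S₀, hS₀⟩⟩
  obtain ⟨⟨S, hS⟩, hSx⟩ := exists_eq_ciInf_of_finite
    (f := fun S : {S : Finset Y // S.card = k + 1} => ⨆ y : (S : Finset Y), dist x (y : Y))
  have hle : ∀ y ∈ S, dist x y ≤ Nk k X := by
    intro y hy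
    refine (le_ciSup (f := fun y : S => dist x (y : Y)) (Set.finite_range _).bddAbove
      ⟨y, hy⟩).trans (hSx.le.trans ?_)
    exact le_ciSup (f := fun x : X => ⨅ S : {S : Finset Y // S.card = k + 1},
      ⨆ y : (S : Finset Y), dist (x : Y) (y : Y)) (Set.finite_range _).bddAbove ⟨x, hx⟩
  have hk : k ≤ (S.erase x).card := by
    have := Finset.pred_card_le_card_erase (s := S) (a := x)
    omega
  rw [← Set.ncard_coe_finset] at hk
  refine hk.trans (Set.ncard_le_ncard (fun y hy => ?_) (Set.toFinite _))
  have hy' := Finset.mem_erase.1 (Finset.mem_coe.1 hy)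
  exact ⟨hy'.1, hle y hy'.2⟩

/-- Below the scale at which `X` becomes connected, a layer point of `X` is followed by a gap in
the distances of `X`. -/
theorem dist_le_of_mem_LambdaVR {Y : Type*} [MetricSpace Y] {X : Set Y} {U M : ℕ} {σ : ℕ → ℝ}
    {δ : ℝ} (hσ0 : σ 0 = 0) (hσmono : ∀ i j : ℕ, i < j → j ≤ U → σ i < σ j)
    (hσrange : {r : ℝ | ∃ x ∈ X, ∃ x' ∈ X, r = dist x x'} = σ '' {i : ℕ | i ≤ U})
    (hMU : M ≤ U) (hgap : ∀ i : ℕ, i < M → δ < σ (i + 1) - σ i)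
    {p : ℝ × Set Y} (hp : p ∈ LambdaVR X 0) (hpM : p.1 < σ M) {x x' : Y} (hx : x ∈ X)
    (hx' : x' ∈ X) (hd : dist x x' ≤ p.1 + δ) : dist x x' ≤ p.1 := by
  classical
  have hex : ∃ n, p.1 < σ n := ⟨M, hpM⟩
  obtain ⟨i, hi⟩ : ∃ i, Nat.find hex = i + 1 := by
    refine Nat.exists_eq_succ_of_ne_zero fun h0 => ?_
    have := Nat.find_spec hex
    rw [h0, hσ0] at this
    exact absurd hp.1 (not_le.2 this)
  have hlt : p.1 < σ (i + 1) := hi ▸ Nat.find_spec hex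
  have hle : σ i ≤ p.1 := not_lt.1 (Nat.find_min hex (by omega))
  have hiM : i + 1 ≤ M := hi ▸ Nat.find_min' hex hpM
  have hfloor : ∀ x ∈ X, ∀ x' ∈ X, dist x x' < σ (i + 1) → dist x x' ≤ σ i := by
    intro x hx x' hx' h
    have hmem : dist x x' ∈ σ '' {i : ℕ | i ≤ U} := hσrange ▸ ⟨x, hx, x', hx', rfl⟩
    obtain ⟨j, hj, hjd⟩ := hmem
    rw [← hjd] at h ⊢
    have hj' : j ≤ U := hj
    rcases lt_trichotomy j i with hji | rfl | hji
    · exact (hσmono j i hji (by omega)).le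
    · exact le_rfl
    · rcases eq_or_lt_of_le (Nat.succ_le_of_lt hji) with h' | h'
      · subst h'
        exact absurd h (lt_irrefl _)
      · exact absurd (hσmono _ _ h' hj') h.le.not_gt
  have hσi : 0 ≤ σ i := by
    rcases Nat.eq_zero_or_pos i with rfl | hpos
    · exact hσ0.ge
    · exact hσ0 ▸ (hσmono 0 i hpos (by omega)).le
  have hadj : adjRel X p.1 = adjRel X (σ i) := by
    ext a b
    exact ⟨fun h => ⟨h.1, h.2.1, h.2.2.1, hfloor a h.1 b h.2.1 (h.2.2.2.trans_lt hlt)⟩,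
      adjRel.mono subset_rfl hle⟩
  have hcc : IsCC X (σ i) p.2 := by
    have := hp.2.1
    simpa only [IsCC, Reach, hadj] using this
  have hpi : p.1 ≤ σ i := by
    by_contra! h
    exact hp.2.2 _ hσi h hcc
  refine (hfloor x hx x' hx' ?_).trans hle
  have := hgap i hiM
  linarith

/-- If `N_k(X,Y) + 2h(Y,X) < s_{i+1} − s_i` for all `i < M` (where
`s₀ = 0 < s₁ < ⋯ < s_U` are the phase change numbers of `X` and `V_s(X)` is
connected for `s ≥ s_M`), then `Λ(L₀X)` is a retract of `Λ(L_kY)`. -/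
theorem statement15 {Y : Type*} [MetricSpace Y] [Fintype Y] (k : ℕ) (X : Set Y)
    (hX : X.Nonempty) (hcard : k + 1 ≤ Fintype.card Y)
    (U M : ℕ) (σ : ℕ → ℝ) (hσ0 : σ 0 = 0)
    (hσmono : ∀ i j : ℕ, i < j → j ≤ U → σ i < σ j)
    (hσrange : {r : ℝ | ∃ x ∈ X, ∃ x' ∈ X, r = dist x x'} = σ '' {i : ℕ | i ≤ U})
    (hMU : M ≤ U)
    (hconn : ∀ s : ℝ, σ M ≤ s → IsCC X s X)
    (hgap : ∀ i : ℕ, i < M → Nk k X + 2 * dirHaus X < σ (i + 1) - σ i) :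
    ∃ (ι : LambdaVR X 0 → LambdaLes Y k) (ρ : LambdaLes Y k → LambdaVR X 0),
      Monotone ι ∧ Monotone ρ ∧ ∀ a, ρ (ι a) = a := by
  have hN := Nk_nonneg k X
  have hh := dirHaus_nonneg X
  have hXV : ∀ s : ℝ, 0 ≤ s → X ⊆ lesnickVerts Y k (s + Nk k X) := fun s hs =>
    (subset_lesnickVerts X hcard).trans (lesnickVerts_mono k (by linarith))
  obtain ⟨θ, hθX, hθd, hθ⟩ := exists_nearest hX
  have exι : ∀ p : LambdaVR X 0, ∃ q : LambdaLes Y k, p.1.2 ⊆ q.1.2 ∧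
      IsCC (lesnickVerts Y k (p.1.1 + Nk k X)) (p.1.1 + Nk k X) q.1.2 := by
    rintro ⟨⟨s, S⟩, hs, ⟨a, ha, hSa⟩, hmin⟩
    have hs' : (0 : ℝ) ≤ s := hs
    have hT : IsCC (lesnickVerts Y k (s + Nk k X)) (s + Nk k X)
        {b | Reach (lesnickVerts Y k (s + Nk k X)) (s + Nk k X) a b} :=
      ⟨a, hXV s hs' ha, rfl⟩
    obtain ⟨t, ht⟩ := exists_mem_LambdaLes (by linarith) hT
    refine ⟨⟨_, ht⟩, ?_, hT⟩
    refine IsCC.subset_of_adjRel (fun _ _ => adjRel.mono (hXV s hs') (by linarith))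
      ⟨a, ha, hSa⟩ hT ⟨a, ?_, Relation.ReflTransGen.refl⟩
    rw [hSa]
    exact Relation.ReflTransGen.refl
  have exρ : ∀ q : LambdaLes Y k, ∃ p : LambdaVR X 0, θ '' q.1.2 ⊆ p.1.2 ∧
      IsCC X (q.1.1 + 2 * dirHaus X) p.1.2 := by
    rintro ⟨⟨t, T⟩, ht, ⟨a, ha, hTa⟩, hmin⟩
    have ht' : (0 : ℝ) ≤ t := ht
    have hS : IsCC X (t + 2 * dirHaus X) {b | Reach X (t + 2 * dirHaus X) (θ a) b} :=
      ⟨θ a, hθX a, rfl⟩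
    obtain ⟨s, hs⟩ := exists_mem_LambdaVR (by linarith) hS
    refine ⟨⟨_, hs⟩, ?_, hS⟩
    rintro _ ⟨b, hb, rfl⟩
    have hab : Reach (lesnickVerts Y k t) t a b := by
      have hb' : b ∈ T := hb
      rwa [show T = _ from hTa] at hb'
    refine Relation.ReflTransGen.trans_induction_on (motive := fun {a b} _ =>
      Reach X (t + 2 * dirHaus X) (θ a) (θ b)) hab (fun _ => Relation.ReflTransGen.refl) ?_
      (fun _ _ h₁ h₂ => Relation.ReflTransGen.trans h₁ h₂)
    intro c d hcd
    by_cases hne : θ c = θ d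
    · rw [hne]
      exact Relation.ReflTransGen.refl
    · refine Relation.ReflTransGen.single ⟨hθX c, hθX d, hne, ?_⟩
      have h₁ := dist_triangle4 (θ c) c d (θ d)
      have h₂ := hθd c
      have h₃ := hθd d
      have h₄ := hcd.2.2.2
      rw [dist_comm (θ c) c] at h₁
      linarith
  choose ι hι₁ hι₂ using exι
  choose ρ hρ₁ hρ₂ using exρ
  refine ⟨ι, ρ, fun p p' hpp => ?_, fun q q' hqq => ?_, fun p => ?_⟩
  · have h₁ : p.1.1 ≤ p'.1.1 := hpp.1
    have h₂ : p.1.2 ⊆ p'.1.2 := hpp.2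
    have hsub : (ι p).1.2 ⊆ (ι p').1.2 :=
      (hι₂ p).subset_of_adjRel
        (fun _ _ => adjRel.mono (lesnickVerts_mono k (by linarith)) (by linarith)) (hι₂ p')
        (p.2.2.1.nonempty.mono fun x hx => ⟨hι₁ p hx, hι₁ p' (h₂ hx)⟩)
    exact ⟨LambdaLes_fst_le (ι p).2 (ι p').2 hsub, hsub⟩
  · have h₁ : q.1.1 ≤ q'.1.1 := hqq.1
    have h₂ : q.1.2 ⊆ q'.1.2 := hqq.2
    have hsub : (ρ q).1.2 ⊆ (ρ q').1.2 := by
      refine (hρ₂ q).subset_of_adjRel (fun _ _ => adjRel.mono subset_rfl (by linarith)) (hρ₂ q') ?_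
      obtain ⟨y, hy⟩ := q.2.2.1.nonempty
      exact ⟨θ y, hρ₁ q ⟨y, hy, rfl⟩, hρ₁ q' ⟨y, h₂ hy, rfl⟩⟩
    exact ⟨LambdaVR_fst_le (ρ q).2 (ρ q').2 hsub, hsub⟩
  · have hp0 : (0 : ℝ) ≤ p.1.1 := p.2.1
    have hsub : p.1.2 ⊆ (ρ (ι p)).1.2 := fun x hx =>
      hρ₁ (ι p) ⟨x, hι₁ p hx, hθ x (p.2.2.1.subset_verts hx)⟩
    have hinter : ((ρ (ι p)).1.2 ∩ p.1.2).Nonempty :=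
      p.2.2.1.nonempty.mono fun x hx => ⟨hsub hx, hx⟩
    have hsup : (ρ (ι p)).1.2 ⊆ p.1.2 := by
      rcases le_or_gt (σ M) p.1.1 with hM | hM
      · have hXp : X ⊆ p.1.2 := (hconn _ hM).subset_of_adjRel (fun _ _ h => h) p.2.2.1
          (p.2.2.1.nonempty.mono fun x hx => ⟨p.2.2.1.subset_verts hx, hx⟩)
        exact (hρ₂ (ι p)).subset_verts.trans hXp
      · have ht : (ι p).1.1 ≤ p.1.1 + Nk k X :=
          layer_le_of_subset (lesnickVerts_mono k) (ι p).2.2.1 (ι p).2.2.2 (by linarith)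
            (hι₂ p) subset_rfl
        refine (hρ₂ (ι p)).subset_of_adjRel (fun a b hab => ?_) p.2.2.1 hinter
        refine ⟨hab.1, hab.2.1, hab.2.2.1, ?_⟩
        refine dist_le_of_mem_LambdaVR hσ0 hσmono hσrange hMU hgap p.2 hM hab.1 hab.2.1 ?_
        have := hab.2.2.2
        linarith
    refine Subtype.ext (Prod.ext ?_ (hsup.antisymm hsub))
    exact le_antisymm (LambdaVR_fst_le (ρ (ι p)).2 p.2 hsup) (LambdaVR_fst_le p.2 (ρ (ι p)).2 hsub)
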